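/- Let n ≥ 2, p > n − 2, M > 0, V > 0 and D > 0. There exists a constant C > 0 depending only on n, p, M, V, D such that the following holds: for every bounded open convex set Ω ⊂ ℝⁿ with |Ω| = V and diam(Ω) = D, and every nonzero convex function u that is continuous on the closure of Ω, twice continuously differentiable in Ω, and satisfies det D²u(x) = M·|u(x)|^p for all x ∈ Ω and u = 0 on ∂Ω, one has |u(x)| ≤ C · dist(x, ∂Ω) · sup_{Ω} |u| for all x ∈ Ω. -/

import Mathlib

open Metric MeasureTheory Real

/-- The Hessian matrix of `u : ℝⁿ → ℝ` at `x`, with entries the second partial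
derivatives `∂²u/∂xᵢ∂xⱼ` computed via iterated Fréchet derivatives. -/
noncomputable def hessianMatrix {n : ℕ} (u : EuclideanSpace ℝ (Fin n) → ℝ)
    (x : EuclideanSpace ℝ (Fin n)) : Matrix (Fin n) (Fin n) ℝ :=
  Matrix.of fun i j =>
    fderiv ℝ (fun y => fderiv ℝ u y (EuclideanSpace.single j 1)) x (EuclideanSpace.single i 1)

/-- The determinant of the Hessian matrix, `det D²u(x)`. -/
noncomputable def hessianDet {n : ℕ} (u : EuclideanSpace ℝ (Fin n) → ℝ)
    (x : EuclideanSpace ℝ (Fin n)) : ℝ := (hessianMatrix u x).det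

open scoped Matrix in
theorem Matrix.PosSemidef.one_le_det_one_add {n : Type*} [Fintype n] [DecidableEq n]
    {Q : Matrix n n ℝ} (hQ : Q.PosSemidef) : 1 ≤ (1 + Q).det := by
  have hH : (1 + Q).IsHermitian := Matrix.isHermitian_one.add hQ.1
  rw [hH.det_eq_prod_eigenvalues]
  refine Finset.one_le_prod fun i _ => ?_
  have h := hH.eigenvalues_eq i
  have hn : (⇑(hH.eigenvectorBasis i) : n → ℝ) ⬝ᵥ ⇑(hH.eigenvectorBasis i) = 1 := by
    have := hH.eigenvectorBasis.orthonormal.1 i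
    have h2 : ‖hH.eigenvectorBasis i‖ ^ 2 = 1 := by rw [this]; norm_num
    rw [EuclideanSpace.real_norm_sq_eq] at h2
    rw [← h2]
    simp [dotProduct, sq]
  have hq := hQ.dotProduct_mulVec_nonneg ⇑(hH.eigenvectorBasis i)
  simp only [star_trivial, Matrix.add_mulVec, Matrix.one_mulVec, dotProduct_add, hn] at h hq
  simp only [RCLike.re_to_real] at h
  change 1 ≤ hH.eigenvalues i
  linarith

theorem Matrix.PosDef.det_le_det {n : Type*} [Fintype n] [DecidableEq n]
    {A B : Matrix n n ℝ} (hB : B.PosDef) (hAB : (A - B).PosSemidef) : B.det ≤ A.det := by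
  classical
  open scoped MatrixOrder ComplexOrder in
  obtain ⟨C, hC⟩ := CStarAlgebra.nonneg_iff_eq_star_mul_self.mp hB.posSemidef.nonneg
  rw [Matrix.star_eq_conjTranspose] at hC
  have hdet : B.det = C.det * C.det := by
    rw [hC, Matrix.det_mul, Matrix.det_conjTranspose, star_trivial]
  have hC0 : IsUnit C.det := by
    rw [isUnit_iff_ne_zero]; intro h
    have := hB.det_pos
    rw [hdet, h] at this; simp at this
  have hQ := hAB.conjTranspose_mul_mul_same C⁻¹
  have hA : A = C.conjTranspose * (1 + (C⁻¹).conjTranspose * (A - B) * C⁻¹) * C := by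
    have h1 : C.conjTranspose * (C⁻¹).conjTranspose = 1 := by
      rw [← Matrix.conjTranspose_mul, Matrix.nonsing_inv_mul _ hC0, Matrix.conjTranspose_one]
    have h2 : C⁻¹ * C = 1 := Matrix.nonsing_inv_mul _ hC0
    calc A = B + 1 * (A - B) * 1 := by simp
      _ = C.conjTranspose * C +
          (C.conjTranspose * (C⁻¹).conjTranspose) * (A - B) * (C⁻¹ * C) := by rw [h1, h2, ← hC]
      _ = _ := by noncomm_ring
  have h1 := hQ.one_le_det_one_add
  rw [hA, Matrix.det_mul, Matrix.det_mul, Matrix.det_conjTranspose, star_trivial, hdet]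
  nlinarith [mul_self_nonneg C.det]

theorem nonneg_of_isLocalMin_of_hasDerivAt_of_hasDerivAt {f f' : ℝ → ℝ} {a c : ℝ}
    (hf : ∀ᶠ t in nhds a, HasDerivAt f (f' t) t) (hf' : HasDerivAt f' c a)
    (hmin : IsLocalMin f a) : 0 ≤ c := by
  by_contra! hc
  have hd : deriv f =ᶠ[nhds a] f' := hf.mono fun t ht => ht.deriv
  have h0 : deriv f a = 0 := hmin.deriv_eq_zero
  have h2 : deriv (deriv f) a = c := by rw [hd.deriv_eq, hf'.deriv]
  have hmax := isLocalMax_of_deriv_deriv_neg (f := f) (by rw [h2]; exact hc) h0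
    hf.self_of_nhds.continuousAt
  have hconst : f =ᶠ[nhds a] fun _ => f a := by
    filter_upwards [hmin, hmax] with t h1 h2 using le_antisymm h2 h1
  have h3 : deriv f =ᶠ[nhds a] fun _ => 0 := by
    filter_upwards [hconst.eventuallyEq_nhds] with t ht
    rw [ht.deriv_eq, deriv_const]
  rw [h3.deriv_eq, deriv_const] at h2
  linarith

section Hessian

variable {n : ℕ} {u : EuclideanSpace ℝ (Fin n) → ℝ} {x : EuclideanSpace ℝ (Fin n)}

theorem hessianMatrix_apply_of_contDiffAt (hu : ContDiffAt ℝ 2 u x) (i j : Fin n) :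
    hessianMatrix u x i j = fderiv ℝ (fderiv ℝ u) x (EuclideanSpace.single i 1)
      (EuclideanSpace.single j 1) := by
  have hd : DifferentiableAt ℝ (fderiv ℝ u) x :=
    (hu.fderiv_right (m := 1) (by norm_num)).differentiableAt (by norm_num)
  simp [hessianMatrix, fderiv_clm_apply hd (differentiableAt_const _)]

theorem isHermitian_hessianMatrix (hu : ContDiffAt ℝ 2 u x) : (hessianMatrix u x).IsHermitian := by
  ext i j
  rw [Matrix.conjTranspose_apply, star_trivial, hessianMatrix_apply_of_contDiffAt hu,
    hessianMatrix_apply_of_contDiffAt hu]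
  exact (hu.isSymmSndFDerivAt (by simp)) _ _

open scoped Matrix in
theorem dotProduct_hessianMatrix_mulVec (hu : ContDiffAt ℝ 2 u x) (ξ : EuclideanSpace ℝ (Fin n)) :
    (⇑ξ : Fin n → ℝ) ⬝ᵥ (hessianMatrix u x *ᵥ ⇑ξ) = fderiv ℝ (fderiv ℝ u) x ξ ξ := by
  have hξ : ξ = ∑ i, ξ i • EuclideanSpace.single i (1 : ℝ) := by
    ext j; simp [Finset.sum_apply, Pi.single_apply]
  conv_rhs => rw [hξ]
  simp only [map_sum, map_smul, sum_apply, smul_apply,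
    smul_eq_mul, dotProduct, Matrix.mulVec, Finset.mul_sum, hessianMatrix_apply_of_contDiffAt hu]
  rw [Finset.sum_comm]
  refine Finset.sum_congr rfl fun i _ => Finset.sum_congr rfl fun j _ => ?_
  ring

theorem eventually_hasDerivAt_comp_line (hu : ContDiffAt ℝ 2 u x) (ξ : EuclideanSpace ℝ (Fin n)) :
    ∀ᶠ t in nhds (0 : ℝ),
      HasDerivAt (fun t : ℝ => u (x + t • ξ)) (fderiv ℝ u (x + t • ξ) ξ) t := by
  have hc : Filter.Tendsto (fun t : ℝ => x + t • ξ) (nhds 0) (nhds x) := by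
    have : Continuous fun t : ℝ => x + t • ξ := by fun_prop
    simpa using this.tendsto 0
  filter_upwards [hc.eventually (hu.eventually (by simp))] with t ht
  have hl : HasDerivAt (fun t : ℝ => x + t • ξ) ξ t := by
    simpa using ((hasDerivAt_id t).smul_const ξ).const_add x
  exact (ht.differentiableAt (by norm_num)).hasFDerivAt.comp_hasDerivAt t hl

open scoped Matrix in
theorem hasDerivAt_fderiv_comp_line (hu : ContDiffAt ℝ 2 u x) (ξ : EuclideanSpace ℝ (Fin n)) :
    HasDerivAt (fun t : ℝ => fderiv ℝ u (x + t • ξ) ξ)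
      ((⇑ξ : Fin n → ℝ) ⬝ᵥ (hessianMatrix u x *ᵥ ⇑ξ)) 0 := by
  rw [dotProduct_hessianMatrix_mulVec hu]
  have hd : HasFDerivAt (fderiv ℝ u) (fderiv ℝ (fderiv ℝ u) x) (x + (0 : ℝ) • ξ) := by
    rw [zero_smul, add_zero]
    exact ((hu.fderiv_right (m := 1) (by norm_num)).differentiableAt (by norm_num)).hasFDerivAt
  have hl : HasDerivAt (fun t : ℝ => x + t • ξ) ξ 0 := by
    simpa using ((hasDerivAt_id (0 : ℝ)).smul_const ξ).const_add x
  have h := (ContinuousLinearMap.apply ℝ ℝ ξ).hasFDerivAt.comp_hasDerivAt (0 : ℝ)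
    (hd.comp_hasDerivAt (0 : ℝ) hl)
  exact h

open scoped Matrix in
theorem le_dotProduct_hessianMatrix_of_isLocalMin (hu : ContDiffAt ℝ 2 u x)
    {W : EuclideanSpace ℝ (Fin n) → ℝ} (hmin : IsLocalMin (fun y => u y - W y) x)
    (ξ : EuclideanSpace ℝ (Fin n)) {g' : ℝ → ℝ} {c : ℝ}
    (hg : ∀ᶠ t in nhds (0 : ℝ), HasDerivAt (fun t : ℝ => W (x + t • ξ)) (g' t) t)
    (hg' : HasDerivAt g' c 0) :
    c ≤ (⇑ξ : Fin n → ℝ) ⬝ᵥ (hessianMatrix u x *ᵥ ⇑ξ) := by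
  have hc : Filter.Tendsto (fun t : ℝ => x + t • ξ) (nhds 0) (nhds x) := by
    have : Continuous fun t : ℝ => x + t • ξ := by fun_prop
    simpa using this.tendsto 0
  have hm : IsLocalMin (fun t : ℝ => u (x + t • ξ) - W (x + t • ξ)) 0 := by
    have := hc.eventually hmin
    simpa [IsLocalMin, IsMinFilter] using this
  have := nonneg_of_isLocalMin_of_hasDerivAt_of_hasDerivAt
    (f' := fun t => fderiv ℝ u (x + t • ξ) ξ - g' t)
    (by filter_upwards [eventually_hasDerivAt_comp_line hu ξ, hg] with t h1 h2 using h1.sub h2)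
    ((hasDerivAt_fderiv_comp_line hu ξ).sub hg') hm
  linarith

open scoped Matrix in
theorem dotProduct_hessianMatrix_le_of_isLocalMax (hu : ContDiffAt ℝ 2 u x)
    {W : EuclideanSpace ℝ (Fin n) → ℝ} (hmax : IsLocalMax (fun y => u y - W y) x)
    (ξ : EuclideanSpace ℝ (Fin n)) {g' : ℝ → ℝ} {c : ℝ}
    (hg : ∀ᶠ t in nhds (0 : ℝ), HasDerivAt (fun t : ℝ => W (x + t • ξ)) (g' t) t)
    (hg' : HasDerivAt g' c 0) :
    (⇑ξ : Fin n → ℝ) ⬝ᵥ (hessianMatrix u x *ᵥ ⇑ξ) ≤ c := by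
  have hc : Filter.Tendsto (fun t : ℝ => x + t • ξ) (nhds 0) (nhds x) := by
    have : Continuous fun t : ℝ => x + t • ξ := by fun_prop
    simpa using this.tendsto 0
  have hm : IsLocalMin (fun t : ℝ => W (x + t • ξ) - u (x + t • ξ)) 0 := by
    filter_upwards [hc.eventually hmax] with t ht
    simp only [zero_smul, add_zero]
    linarith
  have := nonneg_of_isLocalMin_of_hasDerivAt_of_hasDerivAt
    (f' := fun t => g' t - fderiv ℝ u (x + t • ξ) ξ)
    (by filter_upwards [eventually_hasDerivAt_comp_line hu ξ, hg] with t h1 h2 using h2.sub h1)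
    (hg'.sub (hasDerivAt_fderiv_comp_line hu ξ)) hm
  linarith

theorem posSemidef_hessianMatrix_of_convexOn {Ω : Set (EuclideanSpace ℝ (Fin n))}
    (hΩ : IsOpen Ω) (hx : x ∈ Ω) (hc : ConvexOn ℝ Ω u) (hu : ContDiffAt ℝ 2 u x) :
    (hessianMatrix u x).PosSemidef := by
  refine Matrix.PosSemidef.of_dotProduct_mulVec_nonneg (isHermitian_hessianMatrix hu) fun v => ?_
  set ξ : EuclideanSpace ℝ (Fin n) := WithLp.toLp 2 v
  set L := fderiv ℝ u x
  have hmin : IsLocalMin (fun y => u y - (u x + L (y - x))) x := by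
    filter_upwards [hΩ.mem_nhds hx] with y hy
    have hφ := hc.comp_affineMap (AffineMap.lineMap x y)
    have hd : HasDerivAt (u ∘ AffineMap.lineMap x y) (L (y - x)) (0 : ℝ) := by
      refine HasFDerivAt.comp_hasDerivAt (0 : ℝ) ?_ AffineMap.hasDerivAt_lineMap
      rw [AffineMap.lineMap_apply_zero]
      exact (hu.differentiableAt (by norm_num)).hasFDerivAt
    have := hφ.le_slope_of_hasDerivAt (x := 0) (y := 1) (by simpa using hx) (by simpa using hy)
      one_pos hd
    simp [slope_def_field] at this
    simp only [sub_self, map_zero, add_zero, map_sub]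
    linarith
  have := le_dotProduct_hessianMatrix_of_isLocalMin (u := u) (W := fun y => u x + L (y - x))
    hu hmin ξ (g' := fun _ => L ξ) (c := 0)
    (Filter.Eventually.of_forall fun t => by
      have h := ((hasDerivAt_id t).mul_const (L ξ)).const_add (u x)
      simpa using h) (hasDerivAt_const _ _)
  simpa [ξ] using this

end Hessian

section Inradius

variable {E : Type*} [NormedAddCommGroup E] [NormedSpace ℝ E] [MeasurableSpace E] [BorelSpace E]

theorem Convex.mul_addHaar_sdiff_translate_le (μ : Measure E) [μ.IsAddHaarMeasure] {Ω : Set E}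
    {D r : ℝ} (hc : Convex ℝ Ω) (ho : IsOpen Ω) (hb : Bornology.IsBounded Ω)
    (hD : diam Ω ≤ D) (N : ℕ) (hr : N * r ≤ D) {y : E} (hy : ‖y‖ ≤ r) :
    N * μ (Ω ∩ {x | x + y ∉ Ω}) ≤ μ (closedBall 0 (2 * D)) := by
  set S := Ω ∩ {x | x + y ∉ Ω} with hS
  rcases S.eq_empty_or_nonempty with h0 | ⟨c, hcS⟩
  · simp [h0]
  have hSm : MeasurableSet S :=
    ho.measurableSet.inter ((ho.measurableSet.preimage (measurable_add_const y)).compl)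
  have key : ∀ x ∈ S, ∀ k : ℕ, 1 ≤ k → x + (k : ℝ) • y ∉ Ω := by
    intro x hx k hk hxk
    refine hx.2 ?_
    have hk0 : (0 : ℝ) < k := by exact_mod_cast hk
    have hk1 : (1 : ℝ) ≤ k := by exact_mod_cast hk
    have := hc hx.1 hxk (a := 1 - 1 / k) (b := 1 / k)
      (by rw [sub_nonneg, div_le_one hk0]; exact hk1) (by positivity) (by ring)
    convert this using 1
    rw [smul_add, smul_smul, one_div, inv_mul_cancel₀ hk0.ne', one_smul, sub_smul, one_smul]
    abel
  have hdisj : (↑(Finset.range N) : Set ℕ).PairwiseDisjoint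
      (fun k : ℕ => (fun x => x + -((k : ℝ) • y)) ⁻¹' S) := by
    have main : ∀ k l : ℕ, k < l → Disjoint ((fun x => x + -((k : ℝ) • y)) ⁻¹' S)
        ((fun x => x + -((l : ℝ) • y)) ⁻¹' S) := by
      intro k l hkl
      rw [Set.disjoint_left]
      intro x hk hl
      refine key _ hl (l - k) (by omega) ?_
      rw [Nat.cast_sub hkl.le]
      have : x + -((l : ℝ) • y) + ((l : ℝ) - k) • y = x + -((k : ℝ) • y) := by module
      rw [this]
      exact hk.1
    intro k _ l _ hkl
    rcases lt_or_gt_of_ne hkl with h | h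
    · exact main k l h
    · exact (main l k h).symm
  have hμ : μ (⋃ k ∈ Finset.range N, (fun x => x + -((k : ℝ) • y)) ⁻¹' S) = N * μ S := by
    rw [measure_biUnion_finset hdisj fun k _ => hSm.preimage (measurable_add_const _)]
    simp [measure_preimage_add_right]
  rw [← hμ, ← Measure.addHaar_closedBall_center μ c]
  refine measure_mono (Set.iUnion₂_subset fun k hk x hx => ?_)
  rw [Finset.mem_range] at hk
  have h1 : dist (x + -((k : ℝ) • y)) c ≤ D := (dist_le_diam_of_mem hb hx.1 hcS.1).trans hD
  have hkN : (k : ℝ) ≤ N := by exact_mod_cast hk.le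
  have h2 : ‖(k : ℝ) • y‖ ≤ D := by
    rw [norm_smul, Real.norm_natCast]
    have := norm_nonneg y
    nlinarith
  rw [mem_closedBall, dist_eq_norm]
  rw [dist_eq_norm] at h1
  calc ‖x - c‖ = ‖(x + -((k : ℝ) • y) - c) + (k : ℝ) • y‖ := by congr 1; abel
    _ ≤ _ := norm_add_le _ _
    _ ≤ 2 * D := by linarith

theorem exists_forall_convex_ball_subset [FiniteDimensional ℝ E] (μ : Measure E) [μ.IsAddHaarMeasure] {V D : ℝ}
    (hV : 0 < V) (hD : 0 < D) :
    ∃ r : ℝ, 0 < r ∧ ∀ Ω : Set E, IsOpen Ω → Bornology.IsBounded Ω → Convex ℝ Ω →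
      μ Ω = ENNReal.ofReal V → diam Ω ≤ D → ∃ z, ball z r ⊆ Ω := by
  set d := Module.finrank ℝ E
  set ω := (μ (closedBall (0 : E) (2 * D))).toReal with hω
  have hωfin : μ (closedBall (0 : E) (2 * D)) = ENNReal.ofReal ω :=
    (ENNReal.ofReal_toReal measure_closedBall_lt_top.ne).symm
  have hω0 : 0 ≤ ω := ENNReal.toReal_nonneg
  obtain ⟨N, hN⟩ := exists_nat_gt ((d + 1) * ω / V)
  have hN0 : (0 : ℝ) < N := lt_of_le_of_lt (by positivity) hN
  rw [div_lt_iff₀ hV] at hN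
  refine ⟨D / N, by positivity, fun Ω ho hb hc hvol hdiam => ?_⟩
  have hne : Ω.Nonempty := by
    rw [Set.nonempty_iff_ne_empty]
    rintro rfl
    simp at hvol
    linarith
  have hr : N * (D / N) ≤ D := by rw [mul_div_cancel₀ _ hN0.ne']
  let F : closedBall (0 : E) (D / N) → Set E := fun y => (Homeomorph.addRight (y : E)) ⁻¹' closure Ω
  have hF : (⋂ y, F y).Nonempty := by
    refine Convex.helly_theorem_compact' (𝕜 := ℝ) (fun y => ?_) (fun y => ?_) fun I hI => ?_
    · exact hc.closure.translate_preimage_left _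
    · exact (Homeomorph.isCompact_preimage _).mpr hb.isCompact_closure
    · by_contra hemp
      have hsub : Ω ⊆ ⋃ y ∈ I, Ω ∩ {x | x + (y : E) ∉ Ω} := by
        intro x hx
        by_contra hx'
        refine hemp ⟨x, Set.mem_iInter₂.mpr fun y hy => subset_closure ?_⟩
        by_contra hxy
        exact hx' (Set.mem_iUnion₂.mpr ⟨y, hy, hx, hxy⟩)
      have h1 : N * μ Ω ≤ I.card * ENNReal.ofReal ω := by
        calc N * μ Ω ≤ N * ∑ y ∈ I, μ (Ω ∩ {x | x + (y : E) ∉ Ω}) := by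
              gcongr
              exact (measure_mono hsub).trans (measure_biUnion_finset_le _ _)
          _ = ∑ y ∈ I, N * μ (Ω ∩ {x | x + (y : E) ∉ Ω}) := Finset.mul_sum _ _ _
          _ ≤ ∑ y ∈ I, ENNReal.ofReal ω := by
              refine Finset.sum_le_sum fun y _ => ?_
              rw [← hωfin]
              exact hc.mul_addHaar_sdiff_translate_le μ ho hb hdiam N hr
                (mem_closedBall_zero_iff.mp y.2)
          _ = _ := by simp
      have hI' : (I.card : ℝ) ≤ d + 1 := by exact_mod_cast hI
      rw [hvol, ← ENNReal.ofReal_natCast, ← ENNReal.ofReal_natCast,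
        ← ENNReal.ofReal_mul (Nat.cast_nonneg _), ← ENNReal.ofReal_mul (Nat.cast_nonneg _),
        ENNReal.ofReal_le_ofReal_iff (mul_nonneg (Nat.cast_nonneg _) hω0)] at h1
      nlinarith
  obtain ⟨z, hz⟩ := hF
  refine ⟨z, ?_⟩
  have hint : interior (closure Ω) = Ω := by
    rw [hc.interior_closure_eq_interior_of_nonempty_interior (by rwa [ho.interior_eq]),
      ho.interior_eq]
  rw [← hint]
  refine interior_maximal (fun x hx => ?_) isOpen_ball
  have := Set.mem_iInter.mp hz ⟨x - z, by
    rw [mem_closedBall, dist_zero_right, ← dist_eq_norm]; exact (mem_ball.mp hx).le⟩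
  simpa [F] using this

end Inradius

theorem ConvexOn.closure_of_continuousOn {E : Type*} [NormedAddCommGroup E] [NormedSpace ℝ E]
    {s : Set E} {f : E → ℝ} (hf : ConvexOn ℝ s f) (hc : ContinuousOn f (closure s)) :
    ConvexOn ℝ (closure s) f := by
  refine ⟨hf.1.closure, fun x hx y hy a b ha hb hab => ?_⟩
  have hxy : (x, y) ∈ closure (s ×ˢ s) := by rw [closure_prod_eq]; exact ⟨hx, hy⟩
  have h1 : ContinuousWithinAt (fun q : E × E => f (a • q.1 + b • q.2)) (s ×ˢ s) (x, y) := by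
    refine ContinuousWithinAt.comp (t := closure s) (f := fun q : E × E => a • q.1 + b • q.2)
      (hc _ (hf.1.closure hx hy ha hb hab)) ?_ ?_
    · exact (by fun_prop : Continuous fun q : E × E => a • q.1 + b • q.2).continuousWithinAt
    · exact fun q hq => subset_closure (hf.1 hq.1 hq.2 ha hb hab)
  have h2 : ContinuousWithinAt (fun q : E × E => a • f q.1 + b • f q.2) (s ×ˢ s) (x, y) := by
    have h3 : ContinuousWithinAt (fun q : E × E => f q.1) (s ×ˢ s) (x, y) :=
      ContinuousWithinAt.comp (t := closure s) (f := Prod.fst) (hc _ hx)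
        continuous_fst.continuousWithinAt fun q hq => subset_closure hq.1
    have h4 : ContinuousWithinAt (fun q : E × E => f q.2) (s ×ˢ s) (x, y) :=
      ContinuousWithinAt.comp (t := closure s) (f := Prod.snd) (hc _ hy)
        continuous_snd.continuousWithinAt fun q hq => subset_closure hq.2
    exact (h3.const_smul a).add (h4.const_smul b)
  exact ContinuousWithinAt.closure_le hxy h1 h2 fun q hq => hf.2 hq.1 hq.2 ha hb hab

theorem ConvexOn.nonpos_of_frontier_eq_zero {E : Type*} [NormedAddCommGroup E] [NormedSpace ℝ E]
    [FiniteDimensional ℝ E] {Ω : Set E} {u : E → ℝ} (ho : IsOpen Ω) (hb : Bornology.IsBounded Ω)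
    (hfr : (frontier Ω).Nonempty) (hc : ContinuousOn u (closure Ω)) (hu : ConvexOn ℝ Ω u)
    (h0 : ∀ x ∈ frontier Ω, u x = 0) : ∀ x ∈ closure Ω, u x ≤ 0 := by
  have hcl := hu.closure_of_continuousOn hc
  intro x hx
  obtain ⟨y, hy⟩ := hfr
  obtain ⟨x₀, hx₀, hmax⟩ := hb.isCompact_closure.exists_isMaxOn ⟨x, hx⟩ hc
  refine (hmax hx).trans ?_
  by_cases hxΩ : x₀ ∈ Ω
  swap
  · exact (h0 x₀ (by rw [ho.frontier_eq]; exact ⟨hx₀, hxΩ⟩)).le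
  have hcont : Filter.Tendsto (fun t : ℝ => x₀ - t • (y - x₀)) (nhdsWithin 0 (Set.Ioi 0))
      (nhds x₀) := by
    have : Continuous fun t : ℝ => x₀ - t • (y - x₀) := by fun_prop
    have h := this.tendsto 0
    simp only [zero_smul, sub_zero] at h
    exact h.mono_left nhdsWithin_le_nhds
  obtain ⟨t, htΩ, ht⟩ := ((hcont.eventually (ho.mem_nhds hxΩ)).and self_mem_nhdsWithin).exists
  replace ht : 0 < t := ht
  replace htΩ : x₀ - t • (y - x₀) ∈ Ω := htΩ
  have hcomb := hcl.2 (subset_closure htΩ) (frontier_subset_closure hy)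
    (by positivity : 0 ≤ 1 / (1 + t)) (by positivity : 0 ≤ t / (1 + t)) (by field_simp)
  have hpt : (1 / (1 + t)) • (x₀ - t • (y - x₀)) + (t / (1 + t)) • y = x₀ := by
    have h1 : (1 : ℝ) + t ≠ 0 := by positivity
    calc _ = (1 / (1 + t)) • ((1 + t) • x₀) := by module
      _ = x₀ := by rw [smul_smul, one_div, inv_mul_cancel₀ h1, one_smul]
  rw [hpt, h0 y hy, smul_zero, add_zero, smul_eq_mul, div_mul_eq_mul_div, one_mul,
    le_div_iff₀ (by positivity)] at hcomb
  have := hmax (subset_closure htΩ)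
  simp only [Set.mem_ofPred_eq] at this
  nlinarith

section Estimates

variable {n : ℕ} {Ω : Set (EuclideanSpace ℝ (Fin n))} {u : EuclideanSpace ℝ (Fin n) → ℝ}

theorem dotProduct_self_eq_norm_sq (ξ : EuclideanSpace ℝ (Fin n)) :
    (⇑ξ : Fin n → ℝ) ⬝ᵥ ⇑ξ = ‖ξ‖ ^ 2 := by
  rw [EuclideanSpace.real_norm_sq_eq]
  simp [dotProduct, sq]

theorem hasDerivAt_norm_sq_add_smul {E : Type*} [NormedAddCommGroup E] [InnerProductSpace ℝ E]
    (z ξ : E) (t : ℝ) :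
    HasDerivAt (fun t : ℝ => ‖z + t • ξ‖ ^ 2) (2 * (inner ℝ z ξ + t * ‖ξ‖ ^ 2)) t := by
  have hl : HasDerivAt (fun t : ℝ => z + t • ξ) ξ t := by
    simpa using ((hasDerivAt_id t).smul_const ξ).const_add z
  convert hl.norm_sq using 2
  rw [inner_add_left, real_inner_smul_left, real_inner_self_eq_norm_sq]

theorem ConvexOn.le_mul_of_ball_subset {E : Type*} [NormedAddCommGroup E] [NormedSpace ℝ E]
    {Ω : Set E} {u : E → ℝ} (hu : ConvexOn ℝ Ω u) (hneg : ∀ x ∈ Ω, u x ≤ 0) {x₀ z y : E} {r D : ℝ}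
    (hr : 0 < r) (hD : 0 < D) (hx₀ : x₀ ∈ Ω) (hz : ball z r ⊆ Ω) (hy : y ∈ closedBall z (r / 2))
    (hyx : dist y x₀ ≤ D) : u y ≤ r / (4 * D + r) * u x₀ := by
  have hmem : y + (r / (4 * D)) • (y - x₀) ∈ Ω := by
    refine hz ?_
    rw [mem_ball, dist_eq_norm]
    rw [mem_closedBall, dist_eq_norm] at hy
    rw [dist_eq_norm] at hyx
    have h1 : ‖(r / (4 * D)) • (y - x₀)‖ ≤ r / 4 := by
      rw [norm_smul, Real.norm_of_nonneg (by positivity)]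
      calc r / (4 * D) * ‖y - x₀‖ ≤ r / (4 * D) * D := by gcongr
        _ = r / 4 := by field_simp
    calc ‖y + (r / (4 * D)) • (y - x₀) - z‖ = ‖(y - z) + (r / (4 * D)) • (y - x₀)‖ := by
          congr 1; abel
      _ ≤ ‖y - z‖ + ‖(r / (4 * D)) • (y - x₀)‖ := norm_add_le _ _
      _ < r := by linarith
  have hcomb := hu.2 hmem hx₀ (by positivity : 0 ≤ 4 * D / (4 * D + r))
    (by positivity : 0 ≤ r / (4 * D + r)) (by field_simp)
  have hpt : (4 * D / (4 * D + r)) • (y + (r / (4 * D)) • (y - x₀)) + (r / (4 * D + r)) • x₀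
      = y := by
    have h1 : 4 * D / (4 * D + r) * (r / (4 * D)) = r / (4 * D + r) := by field_simp
    have h2 : 4 * D / (4 * D + r) + r / (4 * D + r) = 1 := by field_simp
    rw [smul_add, smul_smul, h1, smul_sub]
    calc _ = (4 * D / (4 * D + r) + r / (4 * D + r)) • y := by module
      _ = y := by rw [h2, one_smul]
  rw [hpt] at hcomb
  refine hcomb.trans ?_
  have := mul_nonpos_of_nonneg_of_nonpos (by positivity : 0 ≤ 4 * D / (4 * D + r)) (hneg _ hmem)
  simp only [smul_eq_mul]
  linarith

theorem exists_hessianDet_le_of_ball_subset (ho : IsOpen Ω) (hu2 : ContDiffOn ℝ 2 u Ω)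
    (hu : ConvexOn ℝ Ω u) {z : EuclideanSpace ℝ (Fin n)} {ρ m : ℝ} (hρ : 0 < ρ) (hm : 0 < m)
    (hz : closedBall z ρ ⊆ Ω) (hneg : ∀ x ∈ closedBall z ρ, u x ≤ 0)
    (hge : ∀ x ∈ closedBall z ρ, -m ≤ u x)
    (hdet : ∀ x ∈ closedBall z ρ, hessianDet u x ≠ 0) :
    ∃ y ∈ closedBall z ρ, hessianDet u y ≤ (4 * m / ρ ^ 2) ^ n := by
  set a := 2 * m / ρ ^ 2 with ha
  have ha0 : 0 < a := by positivity
  set w : EuclideanSpace ℝ (Fin n) → ℝ := fun y => a * (‖y - z‖ ^ 2 - ρ ^ 2) with hw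
  have hcont : ContinuousOn (fun y => u y - w y) (closedBall z ρ) :=
    (hu2.continuousOn.mono hz).sub (by fun_prop)
  obtain ⟨y, hy, hmax⟩ := (isCompact_closedBall z ρ).exists_isMaxOn
    ⟨z, mem_closedBall_self hρ.le⟩ hcont
  refine ⟨y, hy, ?_⟩
  have hyball : y ∈ ball z ρ := by
    rw [mem_closedBall] at hy
    refine lt_of_le_of_ne hy fun heq => ?_
    have h1 := hmax (mem_closedBall_self hρ.le)
    simp only [Set.mem_ofPred_eq, hw] at h1
    rw [← dist_eq_norm, ← dist_eq_norm, dist_self, heq] at h1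
    have h2 : a * ρ ^ 2 = 2 * m := by rw [ha]; field_simp
    have h3 := hge z (mem_closedBall_self hρ.le)
    have h4 := hneg y hy
    linarith
  have hloc : IsLocalMax (fun y => u y - w y) y :=
    hmax.isLocalMax (Filter.mem_of_superset (isOpen_ball.mem_nhds hyball) ball_subset_closedBall)
  have hC : ContDiffAt ℝ 2 u y := hu2.contDiffAt (ho.mem_nhds (hz hy))
  have hP : (hessianMatrix u y).PosDef :=
    ((posSemidef_hessianMatrix_of_convexOn ho (hz hy) hu hC).posDef_iff_det_ne_zero).mpr (hdet y hy)
  have hsub : ((4 * m / ρ ^ 2) • (1 : Matrix (Fin n) (Fin n) ℝ) - hessianMatrix u y).PosSemidef := by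
    refine Matrix.PosSemidef.of_dotProduct_mulVec_nonneg ?_ fun v => ?_
    · exact Matrix.IsHermitian.sub (by simp [Matrix.IsHermitian]) hP.1
    set ξ : EuclideanSpace ℝ (Fin n) := WithLp.toLp 2 v
    have h := dotProduct_hessianMatrix_le_of_isLocalMax hC hloc ξ
      (g' := fun t => a * (2 * (inner ℝ (y - z) ξ + t * ‖ξ‖ ^ 2))) (c := a * (2 * ‖ξ‖ ^ 2))
      (Filter.Eventually.of_forall fun t => by
        have := ((hasDerivAt_norm_sq_add_smul (y - z) ξ t).sub_const (ρ ^ 2)).const_mul a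
        simpa only [hw, add_sub_right_comm] using this)
      (by
        have := ((((hasDerivAt_id (0 : ℝ)).mul_const (‖ξ‖ ^ 2)).const_add
          (inner ℝ (y - z) ξ)).const_mul 2).const_mul a
        simpa using this)
    have hn : v ⬝ᵥ v = ‖ξ‖ ^ 2 := dotProduct_self_eq_norm_sq ξ
    simp only [star_trivial, Matrix.sub_mulVec, Matrix.smul_mulVec, Matrix.one_mulVec,
      dotProduct_sub, dotProduct_smul, smul_eq_mul, hn]
    have e : 4 * m / ρ ^ 2 * ‖ξ‖ ^ 2 = a * (2 * ‖ξ‖ ^ 2) := by rw [ha]; ring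
    rw [e]
    exact sub_nonneg.mpr h
  have := hP.det_le_det hsub
  simpa [hessianDet, Matrix.det_smul] using this

end Estimates

section Barrier

variable {n : ℕ}

theorem det_one_add_smul_vecMulVec (k : ℝ) (e : EuclideanSpace ℝ (Fin n)) (he : ‖e‖ = 1) :
    (1 + k • Matrix.vecMulVec (⇑e) (⇑e) : Matrix (Fin n) (Fin n) ℝ).det = 1 + k := by
  have h := Matrix.det_one_add_replicateCol_mul_replicateRow (ι := Unit) (k • (⇑e : Fin n → ℝ)) ⇑e
  rw [← Matrix.vecMulVec_eq, Matrix.smul_vecMulVec, dotProduct_smul, dotProduct_self_eq_norm_sq,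
    he] at h
  simpa using h

/-- The second derivative of the barrier dominates an explicit positive quadratic form. -/
theorem barrier_second_deriv_ge {γ B D s a z ξ b : ℝ} (hγ : 1 < γ) (hs : 0 < s)
    (hz : 0 ≤ z) (hzD : z ≤ D) (hb : |b| ≤ z * ξ)
    (hB : 4 * γ ^ 2 * D ^ 2 + 1 ≤ γ * (γ - 1) * B) :
    s ^ γ * ξ ^ 2 + s ^ (γ - 2) * a ^ 2 ≤
      γ * (γ - 1) * s ^ (γ - 2) * a ^ 2 * (z ^ 2 + B) + 4 * γ * s ^ (γ - 1) * a * b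
        + 2 * s ^ γ * ξ ^ 2 := by
  set S := s ^ (γ - 2) with hS
  have hS0 : 0 < S := rpow_pos_of_pos hs _
  have h1 : s ^ (γ - 1) = S * s := by
    rw [hS, ← rpow_add_one hs.ne']; ring_nf
  have h2 : s ^ γ = S * s ^ 2 := by
    rw [hS, ← rpow_natCast, ← rpow_add hs]; norm_num
  rw [h1, h2]
  have hb2 : b ^ 2 ≤ D ^ 2 * ξ ^ 2 := by
    have h3 : b ^ 2 ≤ (z * ξ) ^ 2 := sq_le_sq' (abs_le.mp hb).1 (abs_le.mp hb).2
    have h4 : z ^ 2 ≤ D ^ 2 := by gcongr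
    nlinarith [sq_nonneg ξ]
  have hcross : 0 ≤ s ^ 2 * ξ ^ 2 + 4 * γ * s * a * b + 4 * γ ^ 2 * D ^ 2 * a ^ 2 := by
    rcases eq_or_ne ξ 0 with rfl | hξ
    · have : b = 0 := by simpa using hb
      subst this
      nlinarith [sq_nonneg (γ * D * a)]
    · have hξ2 : 0 < ξ ^ 2 := by positivity
      have : 0 ≤ ξ ^ 2 * (s ^ 2 * ξ ^ 2 + 4 * γ * s * a * b + 4 * γ ^ 2 * D ^ 2 * a ^ 2) := by
        have e : 4 * γ ^ 2 * a ^ 2 * b ^ 2 ≤ 4 * γ ^ 2 * a ^ 2 * (D ^ 2 * ξ ^ 2) := by gcongr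
        nlinarith [sq_nonneg (s * ξ ^ 2 + 2 * γ * a * b)]
      exact nonneg_of_mul_nonneg_right this hξ2
  have hB' : 0 ≤ a ^ 2 * (γ * (γ - 1) * B - (4 * γ ^ 2 * D ^ 2 + 1)) :=
    mul_nonneg (sq_nonneg a) (sub_nonneg.mpr hB)
  have hγz : 0 ≤ γ * (γ - 1) * a ^ 2 * z ^ 2 := by
    have : 0 < γ - 1 := by linarith
    positivity
  have key : 0 ≤ S * ((s ^ 2 * ξ ^ 2 + 4 * γ * s * a * b + 4 * γ ^ 2 * D ^ 2 * a ^ 2)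
      + a ^ 2 * (γ * (γ - 1) * B - (4 * γ ^ 2 * D ^ 2 + 1)) + γ * (γ - 1) * a ^ 2 * z ^ 2) := by
    positivity
  nlinarith [key]

theorem neg_barrier_le {Ω : Set (EuclideanSpace ℝ (Fin n))} {u : EuclideanSpace ℝ (Fin n) → ℝ}
    (ho : IsOpen Ω) (hb : Bornology.IsBounded Ω) (hcont : ContinuousOn u (closure Ω))
    (hu2 : ContDiffOn ℝ 2 u Ω) (h0 : ∀ x ∈ frontier Ω, u x = 0)
    {y₀ e : EuclideanSpace ℝ (Fin n)} (he : ‖e‖ = 1) {γ A B D L δ q : ℝ} (hγ : 1 < γ) (hA : 0 < A)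
    (hδ : 0 < δ) (hδ1 : δ ≤ 1) (hD : ∀ y ∈ closure Ω, dist y y₀ ≤ D)
    (hside : ∀ y ∈ closure Ω, 0 ≤ inner ℝ (y - y₀) e)
    (hB : 4 * γ ^ 2 * D ^ 2 + 1 ≤ γ * (γ - 1) * B)
    (hL : (D + 1) ^ (γ - 1) * (D ^ 2 + B) ≤ L) (hq : q = n * γ - 2)
    (hdet : ∀ y ∈ Ω, hessianDet u y ≤ A ^ n * (inner ℝ (y - y₀) e + δ) ^ q) :
    ∀ x ∈ Ω, -(A * L * (inner ℝ (x - y₀) e + δ)) ≤ u x := by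
  intro x hx
  set s : EuclideanSpace ℝ (Fin n) → ℝ := fun y => inner ℝ (y - y₀) e + δ with hs
  have hs0 : ∀ y ∈ closure Ω, 0 < s y := fun y hy => by
    have := hside y hy
    simp only [hs]; linarith
  have hB0 : 0 < B := by
    have h1 : 0 < γ * (γ - 1) := mul_pos (by linarith) (by linarith)
    have h2 : 0 < γ * (γ - 1) * B := lt_of_lt_of_le (by positivity) hB
    exact pos_of_mul_pos_right h2 h1.le
  set W : EuclideanSpace ℝ (Fin n) → ℝ :=
    fun y => A * (s y ^ γ * (‖y - y₀‖ ^ 2 + B) - L * s y) with hW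
  have hs_cont : Continuous s := by fun_prop
  have hWc : ContinuousOn W (closure Ω) := by
    refine ContinuousOn.const_mul ?_ A
    refine (ContinuousOn.mul ?_ (by fun_prop)).sub (by fun_prop)
    exact hs_cont.continuousOn.rpow_const fun y hy => Or.inl (hs0 y hy).ne'
  have hWge : ∀ y ∈ closure Ω, -(A * L * s y) ≤ W y := fun y hy => by
    have : 0 ≤ s y ^ γ * (‖y - y₀‖ ^ 2 + B) := by
      have := (hs0 y hy).le
      positivity
    simp only [hW]
    nlinarith
  have hWle : ∀ y ∈ closure Ω, W y ≤ 0 := fun y hy => by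
    have h1 : ‖y - y₀‖ ≤ D := by rw [← dist_eq_norm]; exact hD y hy
    have hD0 : 0 ≤ D := (norm_nonneg _).trans h1
    have h2 : s y ≤ D + 1 := by
      have := real_inner_le_norm (y - y₀) e
      rw [he, mul_one] at this
      simp only [hs]; linarith
    have h3 : s y ^ γ = s y ^ (γ - 1) * s y := by
      rw [← rpow_add_one (hs0 y hy).ne']; ring_nf
    have h4 : s y ^ (γ - 1) ≤ (D + 1) ^ (γ - 1) :=
      rpow_le_rpow (hs0 y hy).le h2 (by linarith)
    have h5 : s y ^ (γ - 1) * (‖y - y₀‖ ^ 2 + B) ≤ L :=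
      le_trans (by gcongr) hL
    simp only [hW]
    rw [h3]
    have h6 := mul_le_mul_of_nonneg_left h5 (hs0 y hy).le
    refine mul_nonpos_of_nonneg_of_nonpos hA.le ?_
    nlinarith
  obtain ⟨y, hy, hmin⟩ := hb.isCompact_closure.exists_isMinOn ⟨x, subset_closure hx⟩
    (hcont.sub hWc)
  suffices h : 0 ≤ u y - W y by
    have h1 : u y - W y ≤ u x - W x := hmin (subset_closure hx)
    have h2 := hWge x (subset_closure hx)
    linarith
  by_cases hyΩ : y ∈ Ω
  swap
  · rw [h0 y (by rw [ho.frontier_eq]; exact ⟨hy, hyΩ⟩)]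
    linarith [hWle y hy]
  exfalso
  have hloc : IsLocalMin (fun y => u y - W y) y :=
    hmin.isLocalMin (Filter.mem_of_superset (ho.mem_nhds hyΩ) subset_closure)
  have hC : ContDiffAt ℝ 2 u y := hu2.contDiffAt (ho.mem_nhds hyΩ)
  have hsy := hs0 y hy
  have hAs : 0 < A * s y ^ γ := by positivity
  set N : Matrix (Fin n) (Fin n) ℝ :=
    (A * s y ^ γ) • (1 + (s y ^ (-2 : ℝ)) • Matrix.vecMulVec (⇑e) (⇑e)) with hN
  have hNdet : N.det = A ^ n * s y ^ q * (s y ^ 2 + 1) := by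
    rw [hN, Matrix.det_smul, det_one_add_smul_vecMulVec _ _ he, Fintype.card_fin, mul_pow,
      ← rpow_natCast (s y ^ γ), ← rpow_mul hsy.le, hq, mul_comm γ, mul_assoc, mul_assoc]
    congr 1
    rw [show (n : ℝ) * γ = (n * γ - 2) + 2 by ring, rpow_add hsy, rpow_neg hsy.le, mul_assoc]
    have : s y ^ (2 : ℝ) = s y ^ 2 := by norm_cast
    rw [this]
    field_simp
    ring_nf
  have hNpos : N.PosDef := by
    have h1 : (s y ^ (-2 : ℝ) • Matrix.vecMulVec (⇑e) (⇑e) : Matrix (Fin n) (Fin n) ℝ).PosSemidef := by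
      have := Matrix.posSemidef_vecMulVec_self_star (⇑e : Fin n → ℝ)
      rw [star_trivial] at this
      exact this.smul (by positivity)
    exact (Matrix.PosDef.one.add_posSemidef h1).smul hAs
  have hsub : (hessianMatrix u y - N).PosSemidef := by
    refine Matrix.PosSemidef.of_dotProduct_mulVec_nonneg
      ((isHermitian_hessianMatrix hC).sub hNpos.1) fun v => ?_
    set ξ : EuclideanSpace ℝ (Fin n) := WithLp.toLp 2 v
    set a : ℝ := inner ℝ ξ e with ha
    set b : ℝ := inner ℝ (y - y₀) ξ with hbdef
    have hst : ∀ t : ℝ, s (y + t • ξ) = s y + t * a := fun t => by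
      simp only [hs, ha]
      rw [show y + t • ξ - y₀ = (y - y₀) + t • ξ by abel, inner_add_left, real_inner_smul_left]
      ring
    have hsd : ∀ t : ℝ, HasDerivAt (fun t : ℝ => s y + t * a) a t := fun t => by
      simpa using ((hasDerivAt_id t).mul_const a).const_add (s y)
    have hpos : ∀ᶠ t in nhds (0 : ℝ), s y + t * a ≠ 0 := by
      have : ContinuousAt (fun t : ℝ => s y + t * a) 0 := (hsd 0).continuousAt
      exact this.eventually_ne (by simpa using hsy.ne')
    have hqd : ∀ t : ℝ, HasDerivAt (fun t : ℝ => ‖y - y₀ + t • ξ‖ ^ 2 + B)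
        (2 * (b + t * ‖ξ‖ ^ 2)) t := fun t =>
      (hasDerivAt_norm_sq_add_smul (y - y₀) ξ t).add_const B
    have hWline : ∀ t : ℝ, W (y + t • ξ) =
        A * ((s y + t * a) ^ γ * (‖y - y₀ + t • ξ‖ ^ 2 + B) - L * (s y + t * a)) := fun t => by
      simp only [hW, hst]
      rw [show y + t • ξ - y₀ = (y - y₀) + t • ξ by abel]
    have hlin : ∀ t : ℝ, HasDerivAt (fun t : ℝ => 2 * (b + t * ‖ξ‖ ^ 2)) (2 * ‖ξ‖ ^ 2) t :=
      fun t => by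
        simpa using (((hasDerivAt_id t).mul_const (‖ξ‖ ^ 2)).const_add b).const_mul 2
    have h := le_dotProduct_hessianMatrix_of_isLocalMin hC hloc ξ
      (g' := fun t => A * ((a * γ * (s y + t * a) ^ (γ - 1)) * (‖y - y₀ + t • ξ‖ ^ 2 + B)
        + (s y + t * a) ^ γ * (2 * (b + t * ‖ξ‖ ^ 2)) - L * a))
      (c := A * (((a * γ) * (a * (γ - 1) * s y ^ (γ - 2))) * (‖y - y₀‖ ^ 2 + B)
        + (a * γ * s y ^ (γ - 1)) * (2 * b)
        + ((a * γ * s y ^ (γ - 1)) * (2 * b) + s y ^ γ * (2 * ‖ξ‖ ^ 2))))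
      (by
        filter_upwards [hpos] with t ht
        simp only [hWline]
        exact (((((hsd t).rpow_const (p := γ) (Or.inl ht)).mul (hqd t)).sub
          ((hsd t).const_mul L)).const_mul A))
      (by
        have ht := hpos.self_of_nhds
        have h1 := ((hsd 0).rpow_const (p := γ - 1) (Or.inl ht)).const_mul (a * γ)
        have h2 := (hsd 0).rpow_const (p := γ) (Or.inl ht)
        have h3 := (((h1.mul (hqd 0)).add (h2.mul (hlin 0))).sub_const (L * a)).const_mul A
        refine h3.congr_deriv ?_
        simp only [zero_mul, add_zero, zero_smul]
        rw [show γ - 1 - 1 = γ - 2 by ring])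
    have hlow := barrier_second_deriv_ge (a := a) (b := b) (z := ‖y - y₀‖) (ξ := ‖ξ‖) hγ hsy
      (norm_nonneg _) (by rw [← dist_eq_norm]; exact hD y hy) (abs_real_inner_le_norm _ _) hB
    have hNv : v ⬝ᵥ (N.mulVec v) = A * (s y ^ γ * ‖ξ‖ ^ 2 + s y ^ (γ - 2) * a ^ 2) := by
      have hvv : v ⬝ᵥ v = ‖ξ‖ ^ 2 := dotProduct_self_eq_norm_sq ξ
      have hev : (⇑e : Fin n → ℝ) ⬝ᵥ v = a := by
        rw [ha, EuclideanSpace.inner_eq_star_dotProduct]; simp [ξ]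
      have hpow : s y ^ (γ - 2) = s y ^ γ * s y ^ (-2 : ℝ) := by
        rw [← rpow_add hsy]; ring_nf
      rw [hN, Matrix.smul_mulVec, Matrix.add_mulVec, Matrix.one_mulVec, Matrix.smul_mulVec,
        Matrix.vecMulVec_mulVec, dotProduct_smul, dotProduct_add, hvv, dotProduct_smul, hev, hpow]
      simp only [op_smul_eq_smul, dotProduct_comm v, smul_dotProduct, hev, smul_eq_mul]
      ring
    simp only [star_trivial, Matrix.sub_mulVec, dotProduct_sub, hNv]
    refine sub_nonneg.mpr (le_trans ?_ h)
    rw [mul_le_mul_iff_right₀ hA]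
    refine hlow.trans (le_of_eq ?_)
    ring
  have h1 := hNpos.det_le_det hsub
  rw [hNdet] at h1
  have h2 : (hessianMatrix u y).det ≤ A ^ n * s y ^ q := hdet y hyΩ
  have h3 : 0 < A ^ n * s y ^ q := by positivity
  nlinarith [mul_pos h3 (pow_pos hsy 2)]

end Barrier

theorem infDist_frontier_le_dist {E : Type*} [NormedAddCommGroup E] [NormedSpace ℝ E]
    [FiniteDimensional ℝ E] {Ω : Set E} {x y : E} (hx : x ∈ Ω) (hy : y ∉ Ω) :
    infDist x (frontier Ω) ≤ dist x y := by
  obtain ⟨z, hz, hzx⟩ := exists_mem_frontier_infDist_compl_eq_dist hx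
    (fun h => hy (h ▸ Set.mem_univ y))
  calc infDist x (frontier Ω) ≤ dist x z := infDist_le_dist_of_mem hz
    _ = infDist x Ωᶜ := hzx.symm
    _ ≤ dist x y := infDist_le_dist_of_mem hy

theorem Convex.exists_unit_forall_inner_pos {E : Type*} [NormedAddCommGroup E]
    [InnerProductSpace ℝ E] [CompleteSpace E] {Ω : Set E} (hc : Convex ℝ Ω) (ho : IsOpen Ω)
    (hne : Ω.Nonempty) {y₀ : E} (hy₀ : y₀ ∉ Ω) :
    ∃ e : E, ‖e‖ = 1 ∧ ∀ y ∈ Ω, 0 < inner ℝ (y - y₀) e := by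
  obtain ⟨f, hf⟩ := geometric_hahn_banach_open_point hc ho hy₀
  set g := (InnerProductSpace.toDual ℝ E).symm (-f) with hg
  have hgf : ∀ y, inner ℝ g y = -f y := fun y => by
    rw [hg, InnerProductSpace.toDual_symm_apply]; rfl
  have hpos : ∀ y ∈ Ω, 0 < inner ℝ (y - y₀) g := fun y hy => by
    rw [real_inner_comm, hgf, map_sub]
    linarith [hf y hy]
  have hg0 : g ≠ 0 := by
    obtain ⟨y, hy⟩ := hne
    intro h
    have := hpos y hy
    rw [h, inner_zero_right] at this
    exact lt_irrefl _ this
  have hn : 0 < ‖g‖ := norm_pos_iff.mpr hg0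
  refine ⟨‖g‖⁻¹ • g, norm_smul_inv_norm hg0, fun y hy => ?_⟩
  rw [real_inner_smul_right]
  exact mul_pos (inv_pos.mpr hn) (hpos y hy)

theorem infDist_frontier_le_inner {E : Type*} [NormedAddCommGroup E]
    [InnerProductSpace ℝ E] [FiniteDimensional ℝ E] {Ω : Set E} {y₀ e : E}
    (he : ‖e‖ = 1) (hpos : ∀ y ∈ Ω, 0 < inner ℝ (y - y₀) e) {y : E} (hy : y ∈ Ω) :
    infDist y (frontier Ω) ≤ inner ℝ (y - y₀) e := by
  set t : ℝ := inner ℝ (y - y₀) e with ht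
  have hout : y - t • e ∉ Ω := fun h => by
    have := hpos _ h
    rw [show y - t • e - y₀ = (y - y₀) - t • e by abel, inner_sub_left, real_inner_smul_left,
      real_inner_self_eq_norm_sq, he, ← ht] at this
    simp at this
  refine (infDist_frontier_le_dist hy hout).trans (le_of_eq ?_)
  rw [dist_eq_norm, sub_sub_cancel, norm_smul, he, mul_one, Real.norm_of_nonneg (hpos y hy).le]

section Lipschitz

variable {n : ℕ} {Ω : Set (EuclideanSpace ℝ (Fin n))} {u : EuclideanSpace ℝ (Fin n) → ℝ}
  {p M : ℝ}

theorem mul_rpow_le_of_ball_subset (ho : IsOpen Ω) (hb : Bornology.IsBounded Ω)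
    (hu2 : ContDiffOn ℝ 2 u Ω) (hu : ConvexOn ℝ Ω u) (hneg : ∀ x ∈ Ω, u x ≤ 0) (hM : 0 < M)
    (hp : 0 ≤ p) (hdet : ∀ x ∈ Ω, hessianDet u x = M * |u x| ^ p)
    {x₀ z : EuclideanSpace ℝ (Fin n)} {r D : ℝ} (hr : 0 < r) (hD : 0 < D) (hdiam : diam Ω ≤ D)
    (hx₀ : x₀ ∈ Ω) (hmin : ∀ y ∈ Ω, u x₀ ≤ u y) (hux₀ : u x₀ < 0) (hz : ball z r ⊆ Ω) :
    M * (-u x₀) ^ p ≤ (4 / (r / 2) ^ 2) ^ n / (r / (4 * D + r)) ^ p * (-u x₀) ^ n := by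
  have hm : 0 < -u x₀ := by linarith
  have hsub : closedBall z (r / 2) ⊆ Ω := (closedBall_subset_ball (by linarith)).trans hz
  have hδ : 0 < r / (4 * D + r) := by positivity
  have hlow : ∀ y ∈ closedBall z (r / 2), r / (4 * D + r) * (-u x₀) ≤ |u y| := fun y hy => by
    have := hu.le_mul_of_ball_subset hneg hr hD hx₀ hz hy
      ((dist_le_diam_of_mem hb (hsub hy) hx₀).trans hdiam)
    rw [abs_of_nonpos (hneg y (hsub hy))]
    linarith
  obtain ⟨y, hy, hyle⟩ := exists_hessianDet_le_of_ball_subset ho hu2 hu (half_pos hr) hm hsub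
    (fun x hx => hneg x (hsub hx)) (fun x hx => by linarith [hmin x (hsub hx)])
    (fun x hx => by
      have : 0 < |u x| := lt_of_lt_of_le (mul_pos hδ hm) (hlow x hx)
      rw [hdet x (hsub hx)]
      positivity)
  rw [hdet y (hsub hy)] at hyle
  have h1 : (r / (4 * D + r) * (-u x₀)) ^ p ≤ |u y| ^ p :=
    rpow_le_rpow (mul_pos hδ hm).le (hlow y hy) hp
  rw [mul_rpow hδ.le hm.le] at h1
  rw [div_mul_eq_mul_div, le_div_iff₀ (rpow_pos_of_pos hδ p), ← mul_pow, div_mul_eq_mul_div]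
  refine le_trans ?_ hyle
  calc M * (-u x₀) ^ p * (r / (4 * D + r)) ^ p = M * ((r / (4 * D + r)) ^ p * (-u x₀) ^ p) := by
        ring
    _ ≤ _ := by gcongr

theorem abs_le_mul_infDist_add (hn : 0 < n) (ho : IsOpen Ω) (hb : Bornology.IsBounded Ω)
    (hΩ : Convex ℝ Ω) (hfr : (frontier Ω).Nonempty) (hcont : ContinuousOn u (closure Ω))
    (hu2 : ContDiffOn ℝ 2 u Ω) (hneg : ∀ x ∈ Ω, u x ≤ 0)
    (hdet : ∀ x ∈ Ω, hessianDet u x = M * |u x| ^ p) (h0 : ∀ x ∈ frontier Ω, u x = 0)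
    (hM : 0 < M) {x₀ : EuclideanSpace ℝ (Fin n)} (hx₀ : x₀ ∈ Ω) (hmin : ∀ y ∈ Ω, u x₀ ≤ u y)
    (hux₀ : u x₀ < 0) {q γ B D L K δ : ℝ} (hq0 : 0 ≤ q) (hqp : q < p) (hqn : q < n)
    (hγ : 1 < γ) (hq : q = n * γ - 2) (hδ : 0 < δ) (hδ1 : δ ≤ 1) (hdiam : diam Ω ≤ D)
    (hB : 4 * γ ^ 2 * D ^ 2 + 1 ≤ γ * (γ - 1) * B)
    (hL : (D + 1) ^ (γ - 1) * (D ^ 2 + B) ≤ L) (hL0 : 0 < L) (hK : 0 < K)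
    (hKm : M * (-u x₀) ^ p ≤ K * (-u x₀) ^ n) :
    ∀ x ∈ Ω, |u x| ≤
      (L ^ n * K) ^ (1 / (n - q)) * (-u x₀) * (infDist x (frontier Ω) + δ) := by
  set d : EuclideanSpace ℝ (Fin n) → ℝ := fun x => infDist x (frontier Ω) with hd
  have hd0 : ∀ x, 0 < d x + δ := fun x => by
    have : 0 ≤ d x := infDist_nonneg
    linarith
  have hm : 0 < -u x₀ := by linarith
  set m := -u x₀ with hmdef
  have hqc : ContinuousOn (fun x => |u x| / (d x + δ)) (closure Ω) :=
    hcont.abs.div ((continuous_infDist_pt _).add continuous_const).continuousOn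
      fun x _ => (hd0 x).ne'
  obtain ⟨x₁, hx₁, hmax⟩ := hb.isCompact_closure.exists_isMaxOn ⟨x₀, subset_closure hx₀⟩ hqc
  set Q := |u x₁| / (d x₁ + δ) with hQ
  have hQle : ∀ x ∈ closure Ω, |u x| ≤ Q * (d x + δ) := fun x hx => by
    have : |u x| / (d x + δ) ≤ Q := hmax hx
    rwa [div_le_iff₀ (hd0 x)] at this
  have hQ0 : 0 < Q := by
    have h1 := hQle x₀ (subset_closure hx₀)
    have h2 : 0 < |u x₀| := abs_pos.mpr hux₀.ne
    exact pos_of_mul_pos_left (h2.trans_le h1) (hd0 x₀).le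
  have hx₁Ω : x₁ ∈ Ω := by
    by_contra h
    have : u x₁ = 0 := h0 x₁ (by rw [ho.frontier_eq]; exact ⟨hx₁, h⟩)
    rw [hQ, this] at hQ0
    simp at hQ0
  suffices hfin : Q ≤ (L ^ n * K) ^ (1 / (n - q)) * m from fun x hx =>
    (hQle x (subset_closure hx)).trans (mul_le_mul_of_nonneg_right hfin (hd0 x).le)
  obtain ⟨y₀, hy₀, hdy₀⟩ := (isClosed_frontier.exists_infDist_eq_dist hfr x₁)
  have hy₀Ω : y₀ ∉ Ω := fun h => by
    rw [ho.frontier_eq] at hy₀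
    exact hy₀.2 h
  obtain ⟨e, he, hpos⟩ := hΩ.exists_unit_forall_inner_pos ho ⟨x₀, hx₀⟩ hy₀Ω
  have hside : ∀ y ∈ closure Ω, 0 ≤ inner ℝ (y - y₀) e := fun y hy =>
    closure_minimal (t := {y | 0 ≤ inner ℝ (y - y₀) e}) (fun y hy => (hpos y hy).le)
      (isClosed_le continuous_const (by fun_prop)) hy
  have hn0 : (n : ℝ) ≠ 0 := by exact_mod_cast hn.ne'
  set T := M * m ^ (p - q) * Q ^ q with hT
  have hT0 : 0 < T := by positivity
  set A := T ^ ((n : ℝ)⁻¹) with hA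
  have hA0 : 0 < A := rpow_pos_of_pos hT0 _
  have hAn : A ^ n = T := rpow_inv_natCast_pow hT0.le hn.ne'
  have hbar := neg_barrier_le ho hb hcont hu2 h0 he hγ hA0 hδ hδ1
    (fun y hy => by
      have := dist_le_diam_of_mem hb.closure hy (frontier_subset_closure hy₀)
      rw [diam_closure] at this
      exact this.trans hdiam) hside hB hL hq
    (fun y hy => by
      rw [hdet y hy, hAn]
      have hdi : d y ≤ inner ℝ (y - y₀) e := infDist_frontier_le_inner he hpos hy
      rcases (abs_nonneg (u y)).eq_or_lt with h | h
      · rw [← h, zero_rpow (by linarith), mul_zero]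
        have := (hpos y hy).le
        positivity
      · have h1 : |u y| ≤ m := by
          rw [abs_of_nonpos (hneg y hy)]
          linarith [hmin y hy]
        have h2 : |u y| ≤ Q * (inner ℝ (y - y₀) e + δ) :=
          (hQle y (subset_closure hy)).trans (by gcongr)
        have h3 : |u y| ^ p = |u y| ^ (p - q) * |u y| ^ q := by
          rw [← rpow_add h]; ring_nf
        have h4 : |u y| ^ (p - q) ≤ m ^ (p - q) := rpow_le_rpow h.le h1 (by linarith)
        have h5 : |u y| ^ q ≤ Q ^ q * (inner ℝ (y - y₀) e + δ) ^ q := by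
          rw [← mul_rpow hQ0.le (by linarith [hpos y hy])]
          exact rpow_le_rpow h.le h2 hq0
        rw [h3, hT]
        calc M * (|u y| ^ (p - q) * |u y| ^ q)
            ≤ M * (m ^ (p - q) * (Q ^ q * (inner ℝ (y - y₀) e + δ) ^ q)) := by gcongr
          _ = _ := by ring) x₁ hx₁Ω
  have hQA : Q ≤ A * L := by
    have h1 : inner ℝ (x₁ - y₀) e ≤ d x₁ := by
      rw [hd]
      simp only
      rw [hdy₀, dist_eq_norm]
      simpa [he] using real_inner_le_norm (x₁ - y₀) e
    rw [hQ, div_le_iff₀ (hd0 x₁), abs_of_nonpos (hneg x₁ hx₁Ω)]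
    have h2 : A * L * (inner ℝ (x₁ - y₀) e + δ) ≤ A * L * (d x₁ + δ) := by gcongr
    linarith
  have hQn : Q ^ n ≤ L ^ n * K * (m ^ ((n : ℝ) - q) * Q ^ q) := by
    have h1 : M * m ^ (p - q) ≤ K * m ^ ((n : ℝ) - q) := by
      rw [rpow_sub hm, rpow_sub hm, ← mul_div_assoc, ← mul_div_assoc, rpow_natCast]
      gcongr
    calc Q ^ n ≤ (A * L) ^ n := by gcongr
      _ = L ^ n * (M * m ^ (p - q) * Q ^ q) := by rw [mul_pow, hAn, hT]; ring
      _ ≤ L ^ n * (K * m ^ ((n : ℝ) - q) * Q ^ q) := by gcongr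
      _ = _ := by ring
  have hnq : 0 < (n : ℝ) - q := by linarith
  have hQq : Q ^ ((n : ℝ) - q) ≤ L ^ n * K * m ^ ((n : ℝ) - q) := by
    rw [rpow_sub hQ0, rpow_natCast, div_le_iff₀ (rpow_pos_of_pos hQ0 q)]
    linarith
  have h6 := rpow_le_rpow (by positivity) hQq (by positivity : 0 ≤ 1 / ((n : ℝ) - q))
  rwa [mul_rpow (by positivity) (by positivity), ← rpow_mul hQ0.le, ← rpow_mul hm.le,
    mul_one_div_cancel hnq.ne', rpow_one, rpow_one] at h6

end Lipschitz

/-- Global Lipschitz estimate for solutions of `det D²u = M |u|^p`,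
`p > n-2`, on bounded open convex domains of given volume and diameter. -/
theorem stmt_0 (n : ℕ) (hn : 2 ≤ n) (p M V D : ℝ)
    (hp : (n : ℝ) - 2 < p) (hM : 0 < M) (hV : 0 < V) (hD : 0 < D) :
    ∃ C : ℝ, 0 < C ∧
      ∀ (Ω : Set (EuclideanSpace ℝ (Fin n))) (u : EuclideanSpace ℝ (Fin n) → ℝ),
        IsOpen Ω → Bornology.IsBounded Ω → Convex ℝ Ω →
        volume Ω = ENNReal.ofReal V → Metric.diam Ω = D →
        ContinuousOn u (closure Ω) → ContDiffOn ℝ 2 u Ω → ConvexOn ℝ Ω u →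
        (∃ x ∈ Ω, u x ≠ 0) →
        (∀ x ∈ Ω, hessianDet u x = M * |u x| ^ p) →
        (∀ x ∈ frontier Ω, u x = 0) →
        ∀ x ∈ Ω, |u x| ≤ C * infDist x (frontier Ω) * sSup ((fun y => |u y|) '' Ω) := by
  have hn2 : (2 : ℝ) ≤ n := by exact_mod_cast hn
  obtain ⟨r, hr, hball⟩ := exists_forall_convex_ball_subset
    (volume : Measure (EuclideanSpace ℝ (Fin n))) hV hD
  obtain ⟨q, hq1, hq2⟩ := exists_between (lt_min hp (by linarith : (n : ℝ) - 2 < n))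
  obtain ⟨hqp, hqn⟩ := lt_min_iff.mp hq2
  set γ := (q + 2) / n with hγdef
  have hγ : 1 < γ := by rw [hγdef, one_lt_div (by linarith)]; linarith
  have hqγ : q = n * γ - 2 := by rw [hγdef]; field_simp; ring
  have hγ1 : 0 < γ * (γ - 1) := mul_pos (by linarith) (by linarith)
  set B := (4 * γ ^ 2 * D ^ 2 + 1) / (γ * (γ - 1)) with hBdef
  have hB0 : 0 < B := by positivity
  have hB : 4 * γ ^ 2 * D ^ 2 + 1 ≤ γ * (γ - 1) * B := by
    rw [hBdef, mul_div_cancel₀ _ hγ1.ne']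
  set L := (D + 1) ^ (γ - 1) * (D ^ 2 + B) with hLdef
  have hL0 : 0 < L := by positivity
  set K := (4 / (r / 2) ^ 2) ^ n / (r / (4 * D + r)) ^ p with hKdef
  have hK : 0 < K := by positivity
  refine ⟨(L ^ n * K) ^ (1 / (n - q)), by positivity, ?_⟩
  intro Ω u ho hb hΩ hvol hdiam hcont hu2 hu hne hdet h0 x hx
  obtain ⟨z, hz⟩ := hball Ω ho hb hΩ hvol hdiam.le
  have : Nonempty (Fin n) := ⟨⟨0, by omega⟩⟩
  have hfr : (frontier Ω).Nonempty := by
    obtain ⟨y, hy, -⟩ := exists_mem_frontier_infDist_compl_eq_dist hx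
      (fun h => NormedSpace.unbounded_univ ℝ (EuclideanSpace ℝ (Fin n)) (h ▸ hb))
    exact ⟨y, hy⟩
  have hneg' := hu.nonpos_of_frontier_eq_zero ho hb hfr hcont h0
  have hneg : ∀ x ∈ Ω, u x ≤ 0 := fun x hx => hneg' x (subset_closure hx)
  obtain ⟨x₀, hx₀', hmin'⟩ := hb.isCompact_closure.exists_isMinOn ⟨x, subset_closure hx⟩ hcont
  have hux₀ : u x₀ < 0 := by
    obtain ⟨y, hy, hy0⟩ := hne
    exact lt_of_le_of_lt (hmin' (subset_closure hy)) (lt_of_le_of_ne (hneg y hy) hy0)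
  have hx₀ : x₀ ∈ Ω := by
    by_contra h
    exact hux₀.ne (h0 x₀ (by rw [ho.frontier_eq]; exact ⟨hx₀', h⟩))
  have hmin : ∀ y ∈ Ω, u x₀ ≤ u y := fun y hy => hmin' (subset_closure hy)
  have hsup : sSup ((fun y => |u y|) '' Ω) = -u x₀ := by
    refine IsGreatest.csSup_eq ⟨⟨x₀, hx₀, abs_of_neg hux₀⟩, ?_⟩
    rintro _ ⟨y, hy, rfl⟩
    simp only [abs_of_nonpos (hneg y hy)]
    linarith [hmin y hy]
  have hKm := mul_rpow_le_of_ball_subset ho hb hu2 hu hneg hM (by linarith) hdet hr hD hdiam.le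
    hx₀ hmin hux₀ hz
  have hmain : ∀ δ : ℝ, 0 < δ → δ ≤ 1 → |u x| ≤
      (L ^ n * K) ^ (1 / (n - q)) * (-u x₀) * (infDist x (frontier Ω) + δ) := fun δ hδ hδ1 =>
    abs_le_mul_infDist_add (by omega) ho hb hΩ hfr hcont hu2 hneg hdet h0 hM hx₀ hmin hux₀
      (by linarith) hqp hqn hγ hqγ hδ hδ1 hdiam.le hB le_rfl hL0 hK hKm x hx
  rw [hsup, mul_right_comm]
  have hlim : Filter.Tendsto (fun δ : ℝ => (L ^ n * K) ^ (1 / (n - q)) * (-u x₀) *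
      (infDist x (frontier Ω) + δ)) (nhdsWithin 0 (Set.Ioi 0))
      (nhds ((L ^ n * K) ^ (1 / (n - q)) * (-u x₀) * infDist x (frontier Ω))) := by
    have hc : Continuous fun δ : ℝ => (L ^ n * K) ^ (1 / (n - q)) * (-u x₀) *
      (infDist x (frontier Ω) + δ) := by fun_prop
    have := hc.tendsto 0
    rw [add_zero] at this
    exact this.mono_left nhdsWithin_le_nhds
  refine ge_of_tendsto hlim ?_
  filter_upwards [Ioc_mem_nhdsGT (zero_lt_one' ℝ)] with δ hδ using hmain δ hδ.1 hδ.2
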